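/- Let M ∈ ℕ with M ≥ 1. Let C4 = {q ∈ V_L : (V_q, σ) is a synchronised subshift} and C5 = V_L \ C4, viewed as subsets of ℝ. Then the Hausdorff dimension of C5 equals 1. -/

import Mathlib

open Classical

/-- The one-sided shift map on sequences. -/
def shift (x : ℕ → ℕ) : ℕ → ℕ := fun i => x (i + 1)

/-- Reflection of a sequence with respect to the alphabet `{0,…,M}`. -/
def reflSeq (M : ℕ) (x : ℕ → ℕ) : ℕ → ℕ := fun i => M - x i

/-- Strict lexicographic order on sequences. -/
def lexLT (x y : ℕ → ℕ) : Prop := ∃ n : ℕ, (∀ i < n, x i = y i) ∧ x n < y n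

/-- Lexicographic order on sequences. -/
def lexLE (x y : ℕ → ℕ) : Prop := x = y ∨ lexLT x y

/-- Strict lexicographic order on words (of the same length). -/
def wordLT (u v : List ℕ) : Prop :=
  ∃ n : ℕ, n < u.length ∧ (∀ i < n, u.getD i 0 = v.getD i 0) ∧ u.getD n 0 < v.getD n 0

/-- Lexicographic order on words (of the same length). -/
def wordLE (u v : List ℕ) : Prop := u = v ∨ wordLT u v

/-- Membership in the full shift over the alphabet `{0,…,M}`. -/
def memSigma (M : ℕ) (x : ℕ → ℕ) : Prop := ∀ i, x i ≤ M

/-- `a` is the quasi-greedy expansion of `1` in base `q` over the alphabet `{0,…,M}`: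
the lexicographically largest sequence with infinitely many nonzero entries satisfying
`∑ a_i q^{-i} = 1`. -/
def IsQuasiGreedy (M : ℕ) (q : ℝ) (a : ℕ → ℕ) : Prop :=
  memSigma M a ∧ (∀ n, ∃ m ≥ n, a m ≠ 0) ∧ (∑' i : ℕ, (a i : ℝ) / q ^ (i + 1)) = 1 ∧
    ∀ b : ℕ → ℕ, memSigma M b → (∀ n, ∃ m ≥ n, b m ≠ 0) →
      (∑' i : ℕ, (b i : ℝ) / q ^ (i + 1)) = 1 → lexLE b a

/-- The quasi-greedy expansion of `1` in base `q` (as a global function, via choice). -/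
noncomputable def qg (M : ℕ) (q : ℝ) : ℕ → ℕ :=
  if h : ∃ a, IsQuasiGreedy M q a then h.choose else fun _ => 0

/-- The set `V` of sequences `a` with `ā ≼ σⁿ(a) ≼ a` for all `n ≥ 0`. -/
def memV (M : ℕ) (a : ℕ → ℕ) : Prop :=
  memSigma M a ∧ ∀ n : ℕ, lexLE (reflSeq M a) (shift^[n] a) ∧ lexLE (shift^[n] a) a

/-- The set `V_L` of bases `q ∈ (1, M+1]` with `α(q) ∈ V`. -/
def memVL (M : ℕ) (q : ℝ) : Prop := 1 < q ∧ q ≤ M + 1 ∧ memV M (qg M q)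

/-- The symmetric `q`-shift `V_q`. -/
def Vq (M : ℕ) (q : ℝ) : Set (ℕ → ℕ) :=
  {x | memSigma M x ∧
    ∀ n : ℕ, lexLE (reflSeq M (qg M q)) (shift^[n] x) ∧ lexLE (shift^[n] x) (qg M q)}

/-- The word `w` occurs as a factor of the sequence `x`. -/
def IsFactorOf (w : List ℕ) (x : ℕ → ℕ) : Prop :=
  ∃ k : ℕ, ∀ i < w.length, x (k + i) = w.getD i 0

/-- Membership in the language of a subshift `X`. -/
def InLang (X : Set (ℕ → ℕ)) (w : List ℕ) : Prop := ∃ x ∈ X, IsFactorOf w x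

/-- The set of admissible words of length `k` of a subshift `X`. -/
def Bn (X : Set (ℕ → ℕ)) (k : ℕ) : Set (List ℕ) := {w | w.length = k ∧ InLang X w}

/-- The specification property. -/
def HasSpecification (X : Set (ℕ → ℕ)) : Prop :=
  ∃ S : ℕ, ∀ u v : List ℕ, InLang X u → InLang X v →
    ∃ w : List ℕ, w.length = S ∧ InLang X (u ++ w ++ v)

/-- Topological transitivity (language formulation). -/
def IsTransitive (X : Set (ℕ → ℕ)) : Prop :=
  ∀ u v : List ℕ, InLang X u → InLang X v → ∃ w : List ℕ, InLang X (u ++ w ++ v)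

/-- Topological mixing (language formulation). -/
def IsMixing (X : Set (ℕ → ℕ)) : Prop :=
  ∀ u v : List ℕ, InLang X u → InLang X v →
    ∃ N : ℕ, ∀ n ≥ N, ∃ w : List ℕ, w.length = n ∧ InLang X (u ++ w ++ v)

/-- Intrinsically synchronising word. -/
def IntrinsicallySynchronising (X : Set (ℕ → ℕ)) (w : List ℕ) : Prop :=
  ∀ u v : List ℕ, InLang X (u ++ w) → InLang X (w ++ v) → InLang X (u ++ w ++ v)

/-- Synchronised subshift: transitive with an intrinsically synchronising word. -/
def IsSynchronised (X : Set (ℕ → ℕ)) : Prop :=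
  IsTransitive X ∧ ∃ w : List ℕ, InLang X w ∧ IntrinsicallySynchronising X w

/-- Subshift of finite type over `{0,…,M}`: determined by a finite set of forbidden words. -/
def IsSFT (M : ℕ) (X : Set (ℕ → ℕ)) : Prop :=
  ∃ F : Finset (List ℕ), X = {x | memSigma M x ∧ ∀ w ∈ F, ¬ IsFactorOf w x}

/-- Coded system: the closure of an increasing union of transitive subshifts of finite type. -/
def IsCoded (M : ℕ) (X : Set (ℕ → ℕ)) : Prop :=
  ∃ Y : ℕ → Set (ℕ → ℕ), (∀ n, IsSFT M (Y n) ∧ IsTransitive (Y n)) ∧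
    (∀ n, Y n ⊆ Y (n + 1)) ∧ X = closure (⋃ n, Y n)

/-- `ω⁻`: decrease the last letter of a word by one. -/
def wMinus (w : List ℕ) : List ℕ := w.dropLast ++ [w.getLast! - 1]

/-- `ω⁺`: increase the last letter of a word by one. -/
def wPlus (w : List ℕ) : List ℕ := w.dropLast ++ [w.getLast! + 1]

/-- Reflection of a word. -/
def wRefl (M : ℕ) (w : List ℕ) : List ℕ := w.map (fun c => M - c)

/-- `ω^∞`: the periodic sequence repeating the word `w`. -/
def perSeq (w : List ℕ) : ℕ → ℕ := fun i => w.getD (i % w.length) 0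

/-- The sequence beginning with the word `u` followed by the periodic sequence `v^∞`. -/
def wordThenPer (u v : List ℕ) : ℕ → ℕ :=
  fun i => if i < u.length then u.getD i 0 else perSeq v (i - u.length)

/-- The prefix of length `n` of a sequence, as a word. -/
def prefixWord (a : ℕ → ℕ) (n : ℕ) : List ℕ := (List.range n).map a

/-- A sequence `a ∈ V` is irreducible if `a_1…a_j (\overline{a_1…a_j}⁺)^∞ ≺ a`
whenever `(a_1…a_j⁻)^∞ ∈ V`. -/
def IrreducibleSeq (M : ℕ) (a : ℕ → ℕ) : Prop :=
  ∀ j : ℕ, 1 ≤ j → memV M (perSeq (wMinus (prefixWord a j))) →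
    lexLT (wordThenPer (prefixWord a j) (wPlus (wRefl M (prefixWord a j)))) a

/-- The set `I` of irreducible bases. -/
def memI (M : ℕ) (q : ℝ) : Prop := memVL M q ∧ IrreducibleSeq M (qg M q)

/-- The set `U` of univoque bases. -/
def memU (M : ℕ) (q : ℝ) : Prop :=
  (1 < q ∧ q < M + 1 ∧ ∀ n : ℕ, 1 ≤ n →
      lexLT (reflSeq M (qg M q)) (shift^[n] (qg M q)) ∧
        lexLT (shift^[n] (qg M q)) (qg M q)) ∨ q = M + 1

/-- The set `U̅`: closure of the set of univoque bases. -/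
def memUbar (M : ℕ) (q : ℝ) : Prop :=
  1 < q ∧ q ≤ M + 1 ∧
    ∀ n : ℕ, lexLT (reflSeq M (qg M q)) (shift^[n] (qg M q)) ∧
      lexLE (shift^[n] (qg M q)) (qg M q)

/-- The indices `n_m` of the natural approximation from below (`approxIdx M q 0 = n_1`). -/
noncomputable def approxIdx (M : ℕ) (q : ℝ) : ℕ → ℕ
  | 0 => sInf {n : ℕ | 1 ≤ n ∧ memV M (perSeq (wMinus (prefixWord (qg M q) n)))}
  | m + 1 => sInf {n : ℕ | approxIdx M q m < n ∧ memV M (perSeq (wMinus (prefixWord (qg M q) n)))}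

/-- The base in `(1, M+1]` whose quasi-greedy expansion is `a` (via choice). -/
noncomputable def baseOf (M : ℕ) (a : ℕ → ℕ) : ℝ :=
  if h : ∃ q : ℝ, 1 < q ∧ q ≤ M + 1 ∧ qg M q = a then h.choose else 0

/-- The natural approximation from below of `q` (`approxBase M q 0 = q_1⁻`),
determined by `α(q_m⁻) = (α_1(q)…α_{n_m}(q)⁻)^∞`. -/
noncomputable def approxBase (M : ℕ) (q : ℝ) (m : ℕ) : ℝ :=
  baseOf M (perSeq (wMinus (prefixWord (qg M q) (approxIdx M q m))))

/-- Strongly irreducible base: `q ∈ I` and all but finitely many terms of the natural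
approximation from below lie in `I`. -/
def memSI (M : ℕ) (q : ℝ) : Prop :=
  memI M q ∧ ∃ N : ℕ, ∀ m ≥ N, memI M (approxBase M q m)

/-- Weakly irreducible base: `q ∈ I` but infinitely many terms of the natural
approximation from below are not in `I`. -/
def memWI (M : ℕ) (q : ℝ) : Prop :=
  memI M q ∧ ∀ N : ℕ, ∃ m ≥ N, ¬ memI M (approxBase M q m)

/-- The generalised golden ratio `q_G(M)`. -/
noncomputable def qG (M : ℕ) : ℝ :=
  if M % 2 = 0 then ((M / 2 : ℕ) : ℝ) + 1
  else (((M / 2 : ℕ) : ℝ) + 1 +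
    Real.sqrt (((M / 2 : ℕ) : ℝ) ^ 2 + 6 * ((M / 2 : ℕ) : ℝ) + 5)) / 2

/-- The metric on `Σ_M`: `d(x,y) = 2^{-j}` where `j` is the first (1-indexed) place
where `x` and `y` differ. -/
noncomputable def seqDist (x y : ℕ → ℕ) : ℝ :=
  if x = y then 0 else (1 / 2 : ℝ) ^ (sInf {i : ℕ | x i ≠ y i} + 1)

/-- Fundamental word (Allaart). -/
def IsFundamentalWord (M : ℕ) (w : List ℕ) : Prop :=
  2 < w.length ∧ ∀ i : ℕ, 1 ≤ i → i ≤ w.length - 1 →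
    wordLE (wRefl M (w.take (w.length - i))) (w.drop i) ∧
      wordLT (w.drop i) (w.take (w.length - i))

/-- The set `I_N`. -/
def memIN (M N : ℕ) (q : ℝ) : Prop :=
  memVL M q ∧
    prefixWord (qg M q) (2 * N) = List.replicate (2 * N - 1) M ++ [0] ∧
    ∀ r : ℕ, 2 ≤ r →
      wordLT (List.replicate N 0) ((List.range N).map (fun i => qg M q (r * N + i))) ∧
      wordLT ((List.range N).map (fun i => qg M q (r * N + i))) (List.replicate N M)

/-- The (forward) orbit of a sequence under the shift. -/
def orbit (a : ℕ → ℕ) : Set (ℕ → ℕ) := {y | ∃ n : ℕ, y = shift^[n] a}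

/-- The tail of `y` from position `t` is seen to be lexicographically smaller than `a` at an index
below `c` and a position below `b`. -/
def BelowAt (a y : ℕ → ℕ) (c b t : ℕ) : Prop :=
  ∃ i < c, t + i < b ∧ (∀ j < i, y (t + j) = a j) ∧ y (t + i) < a i

/-- The tail of `y` from position `t` is seen to lie strictly between the reflection of `a`
and `a`. -/
def BetweenAt (M : ℕ) (a y : ℕ → ℕ) (c b t : ℕ) : Prop :=
  BelowAt a y c b t ∧ BelowAt a (reflSeq M y) c b t

theorem BelowAt.congr {a y a' y' : ℕ → ℕ} {c b t c' b' t' : ℕ} (h : BelowAt a y c b t)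
    (ha : ∀ i < c, a' i = a i) (hy : ∀ i, t + i < b → y' (t' + i) = y (t + i))
    (hc : ∀ i < c, t + i < b → i < c' ∧ t' + i < b') : BelowAt a' y' c' b' t' := by
  obtain ⟨i, hi, hib, h1, h2⟩ := h
  refine ⟨i, (hc i hi hib).1, (hc i hi hib).2, fun j hj => ?_, ?_⟩
  · rw [hy j (by omega), ha j (by omega), h1 j hj]
  · rw [hy i hib, ha i hi]; exact h2

theorem BetweenAt.congr {M : ℕ} {a y a' y' : ℕ → ℕ} {c b t c' b' t' : ℕ}
    (h : BetweenAt M a y c b t)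
    (ha : ∀ i < c, a' i = a i) (hy : ∀ i, t + i < b → y' (t' + i) = y (t + i))
    (hc : ∀ i < c, t + i < b → i < c' ∧ t' + i < b') : BetweenAt M a' y' c' b' t' :=
  ⟨h.1.congr ha hy hc, h.2.congr ha (fun i hi => by simp only [reflSeq, hy i hi]) hc⟩

theorem reflSeq_reflSeq {M : ℕ} {y : ℕ → ℕ} (hy : ∀ i, y i ≤ M) :
    reflSeq M (reflSeq M y) = y := by
  funext i
  have := hy i
  simp only [reflSeq]
  omega

theorem BetweenAt.refl {M : ℕ} {a y : ℕ → ℕ} {c b t : ℕ} (hy : ∀ i, y i ≤ M)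
    (h : BetweenAt M a y c b t) : BetweenAt M a (reflSeq M y) c b t :=
  ⟨h.2, by rw [reflSeq_reflSeq hy]; exact h.1⟩

theorem belowAt_of_ne {M K : ℕ} {a y : ℕ → ℕ} {c b t : ℕ} (ha : ∀ i < K, a i = M) (hK : K ≤ c)
    (hy : ∀ i, y i ≤ M) (h : ∃ i < K, t + i < b ∧ y (t + i) ≠ M) : BelowAt a y c b t := by
  classical
  have hs := Nat.find_spec h
  have hm : ∀ j < Nat.find h, _ := fun j hj => Nat.find_min h hj
  refine ⟨Nat.find h, by omega, hs.2.1, fun j hj => ?_, ?_⟩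
  · have h1 := hm j hj
    rw [ha j (by omega)]
    by_contra h2
    exact h1 ⟨by omega, by omega, h2⟩
  · rw [ha _ hs.1]
    exact lt_of_le_of_ne (hy _) hs.2.2

theorem betweenAt_of_ne {M K : ℕ} {a y : ℕ → ℕ} {c b t : ℕ} (ha : ∀ i < K, a i = M) (hK : K ≤ c)
    (hy : ∀ i, y i ≤ M) (h : ∃ i < K, t + i < b ∧ y (t + i) ≠ M)
    (h0 : ∃ i < K, t + i < b ∧ y (t + i) ≠ 0) : BetweenAt M a y c b t := by
  refine ⟨belowAt_of_ne ha hK hy h, belowAt_of_ne ha hK (fun i => Nat.sub_le _ _) ?_⟩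
  obtain ⟨i, h1, h2, h3⟩ := h0
  refine ⟨i, h1, h2, ?_⟩
  have := hy (t + i)
  simp only [reflSeq]
  omega

/-- No factor of the word `v 0 … v (n - 1)` violates the two-sided lexicographic condition
given by `a`. -/
def Admissible (M : ℕ) (a v : ℕ → ℕ) (n : ℕ) : Prop :=
  (∀ i, v i ≤ M) ∧ ∀ t i, t + i < n →
    ((∀ j < i, v (t + j) = a j) → v (t + i) ≤ a i) ∧
    ((∀ j < i, reflSeq M v (t + j) = a j) → reflSeq M v (t + i) ≤ a i)

theorem Admissible.refl {M : ℕ} {a v : ℕ → ℕ} {n : ℕ} (h : Admissible M a v n) :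
    Admissible M a (reflSeq M v) n := by
  refine ⟨fun i => Nat.sub_le _ _, fun t i hti => ?_⟩
  rw [reflSeq_reflSeq h.1]
  exact (h.2 t i hti).symm

/-- The initial word `a 0 … a (ℓ - 1)`, followed by the digit `M`, can be used as the beginning of
a sequence satisfying the strict two-sided lexicographic condition. -/
structure IsSeed (M K ℓ : ℕ) (a : ℕ → ℕ) : Prop where
  le : ∀ i, a i ≤ M
  top : ∀ i < K, a i = M
  len : K < ℓ
  last : ∀ i, i + 1 = ℓ → a i = 0
  after : a ℓ = M
  between : ∀ t, 1 ≤ t → t + 2 ≤ ℓ → BetweenAt M a a ℓ ℓ t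

theorem belowAt_of_exists_ne {a v : ℕ → ℕ} {n t : ℕ}
    (hv : ∀ i, t + i < n → (∀ j < i, v (t + j) = a j) → v (t + i) ≤ a i)
    (h : ∃ j, t + j < n ∧ v (t + j) ≠ a j) : BelowAt a v n n t := by
  classical
  have hs := Nat.find_spec h
  have hm : ∀ j < Nat.find h, _ := fun j hj => Nat.find_min h hj
  have h1 : ∀ j < Nat.find h, v (t + j) = a j := by
    intro j hj
    have h1 := hm j hj
    by_contra h2
    exact h1 ⟨by omega, h2⟩
  exact ⟨Nat.find h, by omega, hs.1, h1, lt_of_le_of_ne (hv _ hs.1 h1) hs.2⟩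

theorem IsSeed.exists_extension {M K ℓ : ℕ} {a v : ℕ → ℕ} (ha : IsSeed M K ℓ a) (hM : 1 ≤ M)
    (hK : 6 ≤ K) {n z : ℕ} (hn : n ≤ ℓ) (hv : Admissible M a v n) (hzn : z ≤ n)
    (hz : ∀ j, z + j < n → v (z + j) = a j)
    (hlt : ∀ t < z, (∃ j, t + j < n ∧ v (t + j) ≠ a j) ∧
      ∃ j, t + j < n ∧ reflSeq M v (t + j) ≠ a j) (e : ℕ) :
    ∃ y : ℕ → ℕ, (∀ i, y i ≤ M) ∧ (∀ i < n, y i = v i) ∧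
      (∀ t, t + 2 ≤ 2 * ℓ + 8 → BetweenAt M a y (ℓ + 1) (2 * ℓ + 8) t) ∧
      y (2 * ℓ + 7) = if e % 2 = 0 then 0 else M := by
  have hKl := ha.len
  set y : ℕ → ℕ := fun i => if i < z then v i else if i < z + ℓ then a (i - z) else
    if i = z + ℓ then 0 else if (i + e) % 2 = 1 then 0 else M with hy
  have hyle : ∀ i, y i ≤ M := by
    intro i
    have h1 := hv.1 i
    have h2 := ha.le (i - z)
    simp only [hy]
    split_ifs <;> omega
  have hyv : ∀ i < n, y i = v i := by
    intro i hi
    simp only [hy]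
    split_ifs with h1 h2 h3 h4
    · rfl
    · rw [← hz (i - z) (by omega)]; congr 1; omega
    · omega
    · omega
    · omega
  have hpad : ∀ i, z + ℓ < i → y i = if (i + e) % 2 = 1 then 0 else M := by
    intro i hi
    simp only [hy]
    rw [if_neg (by omega), if_neg (by omega), if_neg (by omega)]
  have hcopy : ∀ i < ℓ, y (z + i) = a i := by
    intro i hi
    simp only [hy]
    rw [if_neg (by omega), if_pos (by omega)]
    congr 1; omega
  have hmark : y (z + ℓ) = 0 := by simp [hy]
  refine ⟨y, hyle, hyv, fun t ht => ?_, ?_⟩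
  · rcases lt_or_ge t z with h1 | h1
    · have h2 := hlt t h1
      have h3 : BetweenAt M a v n n t :=
        ⟨belowAt_of_exists_ne (fun i hi => (hv.2 t i hi).1) h2.1,
          belowAt_of_exists_ne (fun i hi => (hv.2 t i hi).2) h2.2⟩
      exact h3.congr (fun _ _ => rfl) (fun i hi => hyv _ hi) (fun i hi hi' => by omega)
    rcases eq_or_lt_of_le h1 with h1 | h1
    · subst h1
      constructor
      · exact ⟨ℓ, by omega, by omega, fun j hj => hcopy j hj, by rw [hmark, ha.after]; omega⟩
      · refine ⟨0, by omega, by omega, by simp, ?_⟩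
        simp only [reflSeq]
        rw [hcopy 0 (by omega), ha.top 0 (by omega)]
        omega
    rcases le_or_gt (t + 2) (z + ℓ) with h2 | h2
    · refine (ha.between (t - z) (by omega) (by omega)).congr (fun _ _ => rfl) (fun i hi => ?_)
        (fun i hi hi' => by omega)
      rw [← hcopy _ hi]
      congr 1; omega
    have hp1 := hpad (t + 1)
    have hp2 := hpad (t + 2)
    have hp3 := hpad (t + 3)
    rcases le_or_gt t (z + ℓ) with h3 | h3
    · have h0 : y t = 0 := by
        rcases eq_or_lt_of_le h3 with h4 | h4
        · rw [h4, hmark]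
        · have := hcopy (t - z) (by omega)
          rw [show z + (t - z) = t by omega] at this
          rw [this, ha.last _ (by omega)]
      refine betweenAt_of_ne ha.top (by omega) hyle ⟨0, by omega, by omega, ?_⟩ ?_
      · simp only [add_zero, h0]; omega
      · by_cases h4 : (t + 2 + e) % 2 = 1
        · exact ⟨3, by omega, by omega, by rw [hp3 (by omega), if_neg (by omega)]; omega⟩
        · exact ⟨2, by omega, by omega, by rw [hp2 (by omega), if_neg (by omega)]; omega⟩
    · have hp0 := hpad t h3
      have hp1 := hp1 (by omega)
      by_cases h4 : (t + e) % 2 = 1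
      · rw [if_pos h4] at hp0
        rw [if_neg (by omega)] at hp1
        exact betweenAt_of_ne ha.top (by omega) hyle
          ⟨0, by omega, by omega, by simp only [add_zero]; omega⟩ ⟨1, by omega, by omega, by omega⟩
      · rw [if_neg h4] at hp0
        rw [if_pos (by omega)] at hp1
        exact betweenAt_of_ne ha.top (by omega) hyle
          ⟨1, by omega, by omega, by omega⟩ ⟨0, by omega, by omega, by simp only [add_zero]; omega⟩
  · rw [hpad _ (by omega)]
    split_ifs <;> omega

/-- A block of length `2 * ℓ + 8` that can be inserted after the seed `a 0 … a (ℓ - 1)` and that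
shows the word `w` whenever `w` is short and admissible. -/
def IsBlock (M ℓ : ℕ) (a : ℕ → ℕ) (w : List ℕ) (y : ℕ → ℕ) : Prop :=
  (∀ i, y i ≤ M) ∧ (y 0 ≠ 0 ∨ y 1 ≠ 0) ∧
    (∀ t, t + 2 ≤ 2 * ℓ + 8 → BetweenAt M a y (ℓ + 1) (2 * ℓ + 8) t) ∧ y (2 * ℓ + 7) = 0 ∧
    (w.length < ℓ → Admissible M a (fun i => w.getD i 0) w.length →
      ∀ i < w.length, y (1 + i) = w.getD i 0)

theorem IsSeed.exists_extension_of_admissible {M K ℓ : ℕ} {a v : ℕ → ℕ} (ha : IsSeed M K ℓ a)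
    (hM : 1 ≤ M) (hK : 6 ≤ K) {n : ℕ} (hn : n ≤ ℓ) (hv : Admissible M a v n) :
    ∃ y : ℕ → ℕ, (∀ i, y i ≤ M) ∧ (∀ i < n, y i = v i) ∧
      (∀ t, t + 2 ≤ 2 * ℓ + 8 → BetweenAt M a y (ℓ + 1) (2 * ℓ + 8) t) ∧ y (2 * ℓ + 7) = 0 := by
  classical
  have hex : ∃ z, z ≤ n ∧ ((∀ j, z + j < n → v (z + j) = a j) ∨
      ∀ j, z + j < n → reflSeq M v (z + j) = a j) :=
    ⟨n, le_rfl, Or.inl fun j hj => by omega⟩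
  obtain ⟨hzn, hz⟩ := Nat.find_spec hex
  have hm : ∀ t < Nat.find hex, (∃ j, t + j < n ∧ v (t + j) ≠ a j) ∧
      ∃ j, t + j < n ∧ reflSeq M v (t + j) ≠ a j := by
    intro t ht
    have h1 := Nat.find_min hex ht
    have h2 : t ≤ n := by omega
    by_contra h3
    apply h1
    refine ⟨h2, ?_⟩
    by_contra h4
    push Not at h4
    exact h3 h4
  rcases hz with hz | hz
  · exact ha.exists_extension hM hK hn hv hzn hz hm 0
  · obtain ⟨y, h1, h2, h3, h4⟩ := ha.exists_extension hM hK hn hv.refl hzn hz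
      (fun t ht => by rw [reflSeq_reflSeq hv.1]; exact (hm t ht).symm) 1
    refine ⟨reflSeq M y, fun i => Nat.sub_le _ _, fun i hi => ?_, fun t ht => (h3 t ht).refl h1, ?_⟩
    · have := hv.1 i
      simp only [reflSeq, h2 i hi]
      omega
    · simp [reflSeq, h4]

theorem Admissible.cons {M K ℓ : ℕ} {a v : ℕ → ℕ} {n : ℕ} (ha : IsSeed M K ℓ a)
    (hM : 1 ≤ M) (hK : 6 ≤ K) (hv : Admissible M a v n) :
    Admissible M a (fun i => if i = 0 then M - v 0 else v (i - 1)) (n + 1) := by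
  have h0 := hv.1 0
  have ha0 := ha.top 0 (by omega)
  have ha1 := ha.top 1 (by omega)
  refine ⟨fun i => ?_, fun t i hti => ?_⟩
  · have := hv.1 (i - 1)
    dsimp only
    split_ifs <;> omega
  · rcases Nat.eq_zero_or_pos t with rfl | ht
    · simp only [zero_add]
      have h1 : i < 2 → a i = M := fun h => ha.top i (by omega)
      have hvi := hv.1 (i - 1)
      rcases lt_or_ge i 2 with hi | hi
      · constructor
        · intro _
          split_ifs <;> omega
        · intro _
          rw [h1 hi]; exact Nat.sub_le _ _
      · constructor <;> intro h <;> exfalso <;> have h2 := h 0 (by omega) <;>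
          have h3 := h 1 (by omega) <;> simp [reflSeq] at h2 h3 <;> omega
    · have := hv.2 (t - 1) i (by omega)
      have h1 : ∀ j, t + j - 1 = t - 1 + j := fun j => by omega
      have h2 : ∀ j, t + j ≠ 0 := fun j => by omega
      simpa [reflSeq, h1, h2, ht.ne'] using this

theorem IsSeed.exists_isBlock {M K ℓ : ℕ} {a : ℕ → ℕ} (ha : IsSeed M K ℓ a)
    (hM : 1 ≤ M) (hK : 6 ≤ K) (w : List ℕ) : ∃ y, IsBlock M ℓ a w y := by
  have key : ∀ w : List ℕ, w.length < ℓ → Admissible M a (fun i => w.getD i 0) w.length →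
      ∃ y, IsBlock M ℓ a w y := by
    intro w hw hadm
    obtain ⟨y, h1, h2, h3, h4⟩ :=
      ha.exists_extension_of_admissible hM hK (by omega) (hadm.cons ha hM hK)
    have h6 : ∀ i < w.length, y (1 + i) = w.getD i 0 := by
      intro i hi
      rw [h2 (1 + i) (by omega)]
      simp
    refine ⟨y, h1, ?_, h3, h4, fun _ _ => h6⟩
    have h7 := h2 0 (by omega)
    simp only [if_true] at h7
    by_contra h8
    push Not at h8
    rcases Nat.eq_zero_or_pos w.length with h9 | h9
    · rw [List.length_eq_zero_iff] at h9
      subst h9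
      simp at h7
      omega
    · have := h6 0 h9
      simp only [add_zero] at this
      omega
  by_cases h : w.length < ℓ ∧ Admissible M a (fun i => w.getD i 0) w.length
  · exact key w h.1 h.2
  · have hl := ha.len
    obtain ⟨y, h1, h2, h3, h4, -⟩ := key [] (by simp; omega) ⟨by simp, by simp⟩
    exact ⟨y, h1, h2, h3, h4, fun h5 h6 => (h ⟨h5, h6⟩).elim⟩

/-- The concatenation of the first `ℓ` digits of `a`, the digits `M` and `0`, the first `B` digits
of `u`, the first `2 * ℓ + 8` digits of `y` and a constant tail. -/
def extendSeq (M ℓ B : ℕ) (a u y : ℕ → ℕ) : ℕ → ℕ := fun i =>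
  if i < ℓ then a i else if i = ℓ then M else if i = ℓ + 1 then 0 else
  if i < ℓ + 2 + B then u (i - (ℓ + 2)) else
  if i < ℓ + 2 + B + (2 * ℓ + 8) then y (i - (ℓ + 2 + B)) else M

theorem IsSeed.extendSeq {M N ℓ B : ℕ} {a u y : ℕ → ℕ} {w : List ℕ}
    (ha : IsSeed M (N + 6) ℓ a) (hM : 1 ≤ M) (hu : ∀ i, u i ≤ M) (hB : 2 ≤ B)
    (hlast : ∀ i, i + 1 = B → u i = 0)
    (hu1 : ∀ i, i + 1 < B → ∃ j < N + 4, i + j < B ∧ u (i + j) ≠ M)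
    (hu0 : ∀ i, i + 1 < B → ∃ j < N + 4, i + j < B ∧ u (i + j) ≠ 0)
    (hy : IsBlock M ℓ a w y) :
    IsSeed M (N + 6) (ℓ + 2 + B + (2 * ℓ + 8)) (extendSeq M ℓ B a u y) := by
  obtain ⟨hy1, hy2, hy3, hy4, -⟩ := hy
  have hl := ha.len
  set b := _root_.extendSeq M ℓ B a u y with hb
  have hba : ∀ i < ℓ, b i = a i := fun i hi => by simp [hb, _root_.extendSeq, hi]
  have hbm : b ℓ = M := by simp [hb, _root_.extendSeq]
  have hbz : b (ℓ + 1) = 0 := by simp [hb, _root_.extendSeq]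
  have hbu : ∀ i < B, b (ℓ + 2 + i) = u i := by
    intro i hi
    simp only [hb, _root_.extendSeq]
    rw [if_neg (by omega), if_neg (by omega), if_neg (by omega), if_pos (by omega)]
    congr 1; omega
  have hby : ∀ i < 2 * ℓ + 8, b (ℓ + 2 + B + i) = y i := by
    intro i hi
    simp only [hb, _root_.extendSeq]
    rw [if_neg (by omega), if_neg (by omega), if_neg (by omega), if_neg (by omega),
      if_pos (by omega)]
    congr 1; omega
  have hble : ∀ i, b i ≤ M := by
    intro i
    have h1 := ha.le i
    have h2 := hu (i - (ℓ + 2))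
    have h3 := hy1 (i - (ℓ + 2 + B))
    simp only [hb, _root_.extendSeq]
    split_ifs <;> omega
  have htop : ∀ i < N + 6, b i = M := fun i hi => by rw [hba i (by omega), ha.top i hi]
  refine ⟨hble, htop, by omega, fun i hi => ?_, ?_, fun t ht1 ht2 => ?_⟩
  · rw [show i = ℓ + 2 + B + (2 * ℓ + 7) by omega, hby _ (by omega), hy4]
  · simp only [hb, _root_.extendSeq]
    rw [if_neg (by omega), if_neg (by omega), if_neg (by omega), if_neg (by omega),
      if_neg (by omega)]
  · rcases le_or_gt (t + 2) ℓ with h | h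
    · exact (ha.between t ht1 h).congr hba (fun i hi => hba _ hi) (fun i hi hi' => by omega)
    rcases eq_or_lt_of_le (show ℓ ≤ t + 1 by omega) with h1 | h1
    · refine betweenAt_of_ne htop (by omega) hble ⟨0, by omega, by omega, ?_⟩
        ⟨1, by omega, by omega, ?_⟩
      · rw [add_zero, hba t (by omega), ha.last t h1.symm]; omega
      · rw [← h1, hbm]; omega
    rcases eq_or_lt_of_le (show ℓ ≤ t by omega) with h2 | h2
    · subst h2
      exact betweenAt_of_ne htop (by omega) hble ⟨1, by omega, by omega, by omega⟩
        ⟨0, by omega, by omega, by simp only [add_zero]; omega⟩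
    rcases eq_or_lt_of_le (show ℓ + 1 ≤ t by omega) with h3 | h3
    · subst h3
      obtain ⟨j, hj1, hj2, hj3⟩ := hu0 0 (by omega)
      refine betweenAt_of_ne htop (by omega) hble
        ⟨0, by omega, by omega, by simp only [add_zero]; omega⟩ ⟨j + 1, by omega, by omega, ?_⟩
      rw [show ℓ + 1 + (j + 1) = ℓ + 2 + (0 + j) by ring, hbu _ (by omega)]
      exact hj3
    rcases le_or_gt (ℓ + 2 + B) t with h4 | h4
    · refine (hy3 (t - (ℓ + 2 + B)) (by omega)).congr (fun i hi => ?_) (fun i hi => ?_)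
        (fun i hi hi' => by omega)
      · rcases eq_or_lt_of_le (show i ≤ ℓ by omega) with h5 | h5
        · rw [h5, hbm, ha.after]
        · exact hba i h5
      · rw [← hby _ hi]; congr 1; omega
    obtain ⟨e, rfl⟩ : ∃ e, t = ℓ + 2 + e := ⟨t - (ℓ + 2), by omega⟩
    rcases eq_or_lt_of_le (show e + 1 ≤ B by omega) with h5 | h5
    · refine betweenAt_of_ne htop (by omega) hble ⟨0, by omega, by omega, ?_⟩ ?_
      · rw [add_zero, hbu e (by omega), hlast e h5]; omega
      · rcases hy2 with h6 | h6
        · refine ⟨1, by omega, by omega, ?_⟩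
          rwa [show ℓ + 2 + e + 1 = ℓ + 2 + B + 0 by omega, hby _ (by omega)]
        · refine ⟨2, by omega, by omega, ?_⟩
          rwa [show ℓ + 2 + e + 2 = ℓ + 2 + B + 1 by omega, hby _ (by omega)]
    · obtain ⟨j, hj1, hj2, hj3⟩ := hu1 e h5
      obtain ⟨i, hi1, hi2, hi3⟩ := hu0 e h5
      refine betweenAt_of_ne htop (by omega) hble ⟨j, by omega, by omega, ?_⟩
        ⟨i, by omega, by omega, ?_⟩
      · rwa [add_assoc, hbu _ hj2]
      · rwa [add_assoc, hbu _ hi2]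

/-- The digits of `x` from position `o` on, cut into chunks of length `N` separated by `M 0`. -/
def chunked (M N o : ℕ) (x : ℕ → ℕ) : ℕ → ℕ := fun e =>
  if e % (N + 2) < N then x (o + (N * (e / (N + 2)) + e % (N + 2)))
  else if e % (N + 2) = N then M else 0

theorem chunked_le {M N o : ℕ} {x : ℕ → ℕ} (hx : ∀ i, x i ≤ M) (e : ℕ) :
    chunked M N o x e ≤ M := by
  have := hx (o + (N * (e / (N + 2)) + e % (N + 2)))
  simp only [chunked]
  split_ifs <;> omega

theorem chunked_mul_add {M N o : ℕ} {x : ℕ → ℕ} (c r : ℕ) (hr : r < N + 2) :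
    chunked M N o x ((N + 2) * c + r) =
      if r < N then x (o + (N * c + r)) else if r = N then M else 0 := by
  have h1 : ((N + 2) * c + r) % (N + 2) = r := by
    rw [Nat.mul_add_mod, Nat.mod_eq_of_lt hr]
  have h2 : ((N + 2) * c + r) / (N + 2) = c := by
    rw [Nat.mul_add_div (by omega), Nat.div_eq_of_lt hr, add_zero]
  simp only [chunked, h1, h2]

theorem chunked_spec {M N o R : ℕ} {x : ℕ → ℕ} (hM : 1 ≤ M) :
    (∀ i, i + 1 = (N + 2) * R → chunked M N o x i = 0) ∧
    (∀ i, i + 1 < (N + 2) * R →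
      ∃ j < N + 4, i + j < (N + 2) * R ∧ chunked M N o x (i + j) ≠ M) ∧
    (∀ i, i + 1 < (N + 2) * R →
      ∃ j < N + 4, i + j < (N + 2) * R ∧ chunked M N o x (i + j) ≠ 0) := by
  have hz : ∀ c, chunked M N o x ((N + 2) * c + (N + 1)) = 0 := fun c => by
    rw [chunked_mul_add _ _ (by omega), if_neg (by omega), if_neg (by omega)]
  have hm : ∀ c, chunked M N o x ((N + 2) * c + N) = M := fun c => by
    rw [chunked_mul_add _ _ (by omega), if_neg (by omega), if_pos rfl]
  have hdec : ∀ i, i < (N + 2) * R → ∃ c r, r < N + 2 ∧ c < R ∧ i = (N + 2) * c + r ∧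
      (N + 2) * c + (N + 2) ≤ (N + 2) * R := by
    intro i hi
    have h1 : i / (N + 2) < R := Nat.div_lt_of_lt_mul hi
    refine ⟨i / (N + 2), i % (N + 2), Nat.mod_lt _ (by omega), h1,
      (Nat.div_add_mod i (N + 2)).symm, ?_⟩
    have := Nat.mul_le_mul_left (N + 2) (show i / (N + 2) + 1 ≤ R by omega)
    linarith [mul_add (N + 2) (i / (N + 2)) 1]
  refine ⟨fun i hi => ?_, fun i hi => ?_, fun i hi => ?_⟩
  · obtain ⟨c, r, hr, hc, rfl, hle⟩ := hdec i (by omega)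
    rw [show r = N + 1 by omega]
    exact hz c
  · obtain ⟨c, r, hr, hc, rfl, hle⟩ := hdec i (by omega)
    refine ⟨N + 1 - r, by omega, by omega, ?_⟩
    rw [show (N + 2) * c + r + (N + 1 - r) = (N + 2) * c + (N + 1) by omega, hz]
    omega
  · obtain ⟨c, r, hr, hc, rfl, hle⟩ := hdec i (by omega)
    rcases eq_or_lt_of_le (show r ≤ N + 1 by omega) with h1 | h1
    · have hcR : c + 1 < R := by
        by_contra h2
        have h3 : c + 1 = R := by omega
        subst h3
        rw [mul_add] at hi
        omega
      have h2 := Nat.mul_le_mul_left (N + 2) (show c + 1 + 1 ≤ R by omega)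
      have h3 : (N + 2) * (c + 1) = (N + 2) * c + (N + 2) := by ring
      have h4 : (N + 2) * (c + 1 + 1) = (N + 2) * c + (N + 2) + (N + 2) := by ring
      refine ⟨N + 1, by omega, by omega, ?_⟩
      rw [show (N + 2) * c + r + (N + 1) = (N + 2) * (c + 1) + N by omega, hm]
      omega
    · refine ⟨N - r, by omega, by omega, ?_⟩
      rw [show (N + 2) * c + r + (N - r) = (N + 2) * c + N by omega, hm]
      omega

/-- The length of the `k`-th seed. -/
def seedLen (N : ℕ) : ℕ → ℕ
  | 0 => N + 9
  | k + 1 => seedLen N k + 2 + (N + 2) * (2 * seedLen N k + 10) + (2 * seedLen N k + 8)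

/-- The number of free digits in the `k`-th seed. -/
def freeLen (N : ℕ) : ℕ → ℕ
  | 0 => 0
  | k + 1 => freeLen N k + N * (2 * seedLen N k + 10)

/-- An enumeration of all words in which every word occurs infinitely often. -/
def wordEnum (k : ℕ) : List ℕ := (Encodable.decode (Nat.unpair k).1).getD []

theorem exists_wordEnum_eq (w : List ℕ) (b : ℕ) : ∃ k ≥ b, wordEnum k = w :=
  ⟨Nat.pair (Encodable.encode w) b, Nat.right_le_pair _ _, by simp [wordEnum]⟩

/-- The `k`-th seed with free digits `x`. -/
noncomputable def seedSeq (M N : ℕ) (x : ℕ → ℕ) : ℕ → ℕ → ℕ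
  | 0 => fun i => if i = N + 6 ∨ i = N + 8 then 0 else M
  | k + 1 => extendSeq M (seedLen N k) ((N + 2) * (2 * seedLen N k + 10)) (seedSeq M N x k)
      (chunked M N (freeLen N k) x)
      (Classical.epsilon (IsBlock M (seedLen N k) (seedSeq M N x k) (wordEnum k)))

theorem lt_seedLen (N k : ℕ) : k < seedLen N k := by
  induction k with
  | zero => simp [seedLen]
  | succ k ih => simp only [seedLen]; omega

theorem seedLen_strictMono (N : ℕ) : StrictMono (seedLen N) :=
  strictMono_nat_of_lt_succ fun k => by simp only [seedLen]; omega

theorem isSeed_seedSeq {M N : ℕ} {x : ℕ → ℕ} (hM : 1 ≤ M) (hx : ∀ i, x i ≤ M) (k : ℕ) :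
    IsSeed M (N + 6) (seedLen N k) (seedSeq M N x k) := by
  induction k with
  | zero =>
    have hle : ∀ i, seedSeq M N x 0 i ≤ M := fun i => by
      simp only [seedSeq]; split_ifs <;> omega
    have htop : ∀ i < N + 6, seedSeq M N x 0 i = M := fun i hi => by
      simp only [seedSeq]; rw [if_neg (by omega)]
    refine ⟨hle, htop, by simp [seedLen], fun i hi => ?_, ?_, fun t ht1 ht2 => ?_⟩
    · simp only [seedLen] at hi
      simp only [seedSeq]; rw [if_pos (by omega)]
    · simp [seedLen, seedSeq]
    · simp only [seedLen] at ht2 ⊢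
      refine betweenAt_of_ne htop (by omega) hle ?_ ?_
      · by_cases h : t ≤ N + 6
        · refine ⟨N + 6 - t, by omega, by omega, ?_⟩
          simp only [seedSeq]; rw [if_pos (by omega)]; omega
        · refine ⟨1, by omega, by omega, ?_⟩
          simp only [seedSeq]; rw [if_pos (by omega)]; omega
      · by_cases h : t = N + 6
        · refine ⟨1, by omega, by omega, ?_⟩
          simp only [seedSeq]; rw [if_neg (by omega)]; omega
        · refine ⟨0, by omega, by omega, ?_⟩
          simp only [seedSeq]; rw [if_neg (by omega)]; omega
  | succ k ih =>
    have hc := chunked_spec (M := M) (N := N) (o := freeLen N k) (R := 2 * seedLen N k + 10)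
      (x := x) hM
    simp only [seedLen, seedSeq]
    refine ih.extendSeq hM (chunked_le hx) (by nlinarith) hc.1 hc.2.1 hc.2.2
      (Classical.epsilon_spec (ih.exists_isBlock hM (by omega) (wordEnum k)))

theorem seedSeq_stable (M N : ℕ) (x : ℕ → ℕ) {k m : ℕ} (h : k ≤ m) :
    ∀ i < seedLen N k, seedSeq M N x m i = seedSeq M N x k i := by
  induction m, h using Nat.le_induction with
  | base => exact fun _ _ => rfl
  | succ m hm ih =>
    intro i hi
    have : i < seedLen N m := lt_of_lt_of_le hi ((seedLen_strictMono N).monotone hm)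
    rw [← ih i hi]
    simp [seedSeq, extendSeq, this]

/-- The sequence with free digits `x` whose initial words are the seeds. -/
noncomputable def limitSeq (M N : ℕ) (x : ℕ → ℕ) : ℕ → ℕ := fun n => seedSeq M N x n n

theorem limitSeq_eq (M N : ℕ) (x : ℕ → ℕ) {k i : ℕ} (hi : i < seedLen N k) :
    limitSeq M N x i = seedSeq M N x k i := by
  rcases le_total k i with h | h
  · exact seedSeq_stable M N x h i hi
  · exact (seedSeq_stable M N x h i (lt_seedLen N i)).symm

theorem limitSeq_le {M N : ℕ} {x : ℕ → ℕ} (hM : 1 ≤ M) (hx : ∀ i, x i ≤ M) (i : ℕ) :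
    limitSeq M N x i ≤ M := (isSeed_seedSeq hM hx i).le i

theorem limitSeq_top {M N : ℕ} {x : ℕ → ℕ} {i : ℕ} (hi : i < N + 6) :
    limitSeq M N x i = M := by
  rw [limitSeq_eq M N x (k := 0) (by simp only [seedLen]; omega)]
  simp only [seedSeq]
  rw [if_neg (by omega)]

theorem limitSeq_zero (M N : ℕ) (x : ℕ → ℕ) : limitSeq M N x (N + 6) = 0 := by
  rw [limitSeq_eq M N x (k := 0) (by simp only [seedLen]; omega)]
  simp [seedSeq]

theorem limitSeq_between {M N : ℕ} {x : ℕ → ℕ} (hM : 1 ≤ M) (hx : ∀ i, x i ≤ M) {t : ℕ}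
    (ht : 1 ≤ t) : ∃ b, BetweenAt M (limitSeq M N x) (limitSeq M N x) b b t := by
  have h := lt_seedLen N (t + 1)
  exact ⟨_, ((isSeed_seedSeq hM hx (t + 1)).between t ht (by omega)).congr
    (fun i hi => limitSeq_eq M N x hi) (fun i hi => limitSeq_eq M N x hi)
    (fun i hi hi' => ⟨hi, hi'⟩)⟩

theorem limitSeq_contains {M N : ℕ} {x : ℕ → ℕ} (hM : 1 ≤ M) (hx : ∀ i, x i ≤ M) {w : List ℕ}
    (hw : Admissible M (limitSeq M N x) (fun i => w.getD i 0) w.length) :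
    ∃ n ≥ 1, ∀ i < w.length, limitSeq M N x (n + i) = w.getD i 0 := by
  obtain ⟨k, hk, hkw⟩ := exists_wordEnum_eq w w.length
  have hl := lt_seedLen N k
  have hseed := isSeed_seedSeq (N := N) hM hx k
  obtain ⟨-, -, -, -, h⟩ :=
    Classical.epsilon_spec (hseed.exists_isBlock hM (by omega) (wordEnum k))
  rw [hkw] at h
  have hadm : Admissible M (seedSeq M N x k) (fun i => w.getD i 0) w.length := by
    refine ⟨hw.1, fun t i hti => ?_⟩
    have h1 : ∀ j ≤ i, limitSeq M N x j = seedSeq M N x k j :=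
      fun j hj => limitSeq_eq M N x (by omega)
    have h2 := hw.2 t i hti
    rw [h1 i le_rfl] at h2
    exact ⟨fun h3 => h2.1 fun j hj => by rw [h3 j hj, h1 j hj.le],
      fun h3 => h2.2 fun j hj => by rw [h3 j hj, h1 j hj.le]⟩
  refine ⟨seedLen N k + 2 + (N + 2) * (2 * seedLen N k + 10) + 1, by omega, fun i hi => ?_⟩
  rw [limitSeq_eq M N x (k := k + 1) (by simp only [seedLen]; omega), ← h (by omega) hadm i hi]
  simp only [seedSeq, extendSeq]
  rw [if_neg (by omega), if_neg (by omega), if_neg (by omega), if_neg (by omega),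
    if_pos (by omega), hkw]
  exact congrArg _ (by omega)

theorem mul_seedLen_le (N k : ℕ) : N * seedLen N k ≤ N * (N + 9) + (N + 3) * freeLen N k := by
  induction k with
  | zero => simp [seedLen, freeLen]
  | succ k ih => simp only [seedLen, freeLen]; nlinarith

theorem exists_limitSeq_eq {N : ℕ} (M : ℕ) (hN : 1 ≤ N) (j : ℕ) :
    ∃ n, N * n ≤ N * (N + 11) + (N + 3) * j ∧ ∀ x, limitSeq M N x n = x j := by
  have hmono : StrictMono (freeLen N) :=
    strictMono_nat_of_lt_succ fun k => by simp only [freeLen]; nlinarith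
  obtain ⟨k, hk1, hk2⟩ : ∃ k, freeLen N k ≤ j ∧ j < freeLen N (k + 1) := by
    have hex : ∃ k, j < freeLen N (k + 1) := ⟨j, hmono.le_apply⟩
    refine ⟨Nat.find hex, ?_, Nat.find_spec hex⟩
    rcases Nat.eq_zero_or_pos (Nat.find hex) with h | h
    · rw [h]; simp [freeLen]
    · have := Nat.find_min hex (show Nat.find hex - 1 < Nat.find hex by omega)
      rw [Nat.sub_add_cancel h] at this
      omega
  obtain ⟨d, rfl⟩ := Nat.exists_eq_add_of_le hk1
  simp only [freeLen] at hk2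
  have hd : N * (d / N) + d % N = d := Nat.div_add_mod d N
  have hr : d % N < N := Nat.mod_lt _ hN
  have hc : d / N < 2 * seedLen N k + 10 := Nat.div_lt_of_lt_mul (by omega)
  set c := d / N
  set r := d % N
  have hc2 := Nat.mul_le_mul_left (N + 2) (show c + 1 ≤ 2 * seedLen N k + 10 by omega)
  have hc3 : (N + 2) * (c + 1) = (N + 2) * c + (N + 2) := by ring
  refine ⟨seedLen N k + 2 + ((N + 2) * c + r), ?_, fun x => ?_⟩
  · have := mul_seedLen_le N k
    rw [← hd]
    nlinarith
  · rw [limitSeq_eq M N x (k := k + 1) (by simp only [seedLen]; omega)]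
    simp only [seedSeq, extendSeq]
    rw [if_neg (by omega), if_neg (by omega), if_neg (by omega), if_pos (by omega),
      show seedLen N k + 2 + ((N + 2) * c + r) - (seedLen N k + 2) = (N + 2) * c + r by omega,
      chunked_mul_add _ _ (by omega), if_pos hr, hd]

/-- The value of the expansion `a` in base `q`. -/
noncomputable def expVal (a : ℕ → ℕ) (q : ℝ) : ℝ := ∑' i : ℕ, (a i : ℝ) / q ^ (i + 1)

theorem hasSum_expVal_const (M : ℕ) {q : ℝ} (hq : 1 < q) :
    HasSum (fun i : ℕ => (M : ℝ) / q ^ (i + 1)) (M / (q - 1)) := by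
  have h := (hasSum_geometric_of_lt_one (r := q⁻¹) (by positivity)
    (inv_lt_one_of_one_lt₀ hq)).mul_left ((M : ℝ) / q)
  have hq0 : q - 1 ≠ 0 := by linarith
  have hq1 : q ≠ 0 := by linarith
  have e1 : (fun i : ℕ => (M : ℝ) / q ^ (i + 1)) = fun i => M / q * q⁻¹ ^ i := by
    funext i
    rw [pow_succ, inv_pow]
    field_simp
  have e2 : (M : ℝ) / (q - 1) = M / q * (1 - q⁻¹)⁻¹ := by
    rw [show 1 - q⁻¹ = (q - 1) / q by field_simp, inv_div]
    field_simp
  rw [e1, e2]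
  exact h

theorem summable_expVal {M : ℕ} {a : ℕ → ℕ} {q : ℝ} (ha : ∀ i, a i ≤ M) (hq : 1 < q) :
    Summable fun i : ℕ => (a i : ℝ) / q ^ (i + 1) := by
  refine Summable.of_nonneg_of_le (fun i => by positivity) (fun i => ?_)
    (hasSum_expVal_const M hq).summable
  have : (a i : ℝ) ≤ M := by exact_mod_cast ha i
  gcongr

theorem expVal_nonneg (a : ℕ → ℕ) {q : ℝ} (hq : 1 < q) : 0 ≤ expVal a q :=
  tsum_nonneg fun i => by positivity

theorem expVal_le {M : ℕ} {a : ℕ → ℕ} {q : ℝ} (ha : ∀ i, a i ≤ M) (hq : 1 < q) :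
    expVal a q ≤ M / (q - 1) := by
  rw [← (hasSum_expVal_const M hq).tsum_eq]
  refine (summable_expVal ha hq).tsum_le_tsum (fun i => ?_) (hasSum_expVal_const M hq).summable
  have : (a i : ℝ) ≤ M := by exact_mod_cast ha i
  gcongr

theorem le_expVal {M : ℕ} {a : ℕ → ℕ} {q : ℝ} (ha : ∀ i, a i ≤ M) (hq : 1 < q) {j : ℕ}
    (hj : a j ≠ 0) : 1 / q ^ (j + 1) ≤ expVal a q := by
  have h1 := (summable_expVal ha hq).le_tsum j (fun i _ => by positivity)
  refine le_trans ?_ h1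
  have : (1 : ℝ) ≤ a j := by exact_mod_cast Nat.one_le_iff_ne_zero.2 hj
  gcongr

theorem expVal_eq_sum_add {M : ℕ} {a : ℕ → ℕ} {q : ℝ} (ha : ∀ i, a i ≤ M) (hq : 1 < q) (n : ℕ) :
    expVal a q = ∑ i ∈ Finset.range n, (a i : ℝ) / q ^ (i + 1) +
      expVal (fun i => a (n + i)) q / q ^ n := by
  rw [expVal, ← (summable_expVal ha hq).sum_add_tsum_nat_add n, expVal, ← tsum_div_const]
  congr 1
  refine tsum_congr fun i => ?_
  rw [div_div, ← pow_add, add_comm n i, show i + n + 1 = i + 1 + n by ring]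

theorem expVal_sub {M : ℕ} {a b : ℕ → ℕ} {q : ℝ} (ha : ∀ i, a i ≤ M) (hb : ∀ i, b i ≤ M)
    (hq : 1 < q) {k : ℕ} (hk : ∀ j < k, b j = a j) :
    expVal b q - expVal a q = ((b k : ℝ) - a k + expVal (fun i => b (k + 1 + i)) q -
      expVal (fun i => a (k + 1 + i)) q) / q ^ (k + 1) := by
  rw [expVal_eq_sum_add ha hq (k + 1), expVal_eq_sum_add hb hq (k + 1), Finset.sum_range_succ,
    Finset.sum_range_succ, Finset.sum_congr rfl fun j hj => by rw [hk j (Finset.mem_range.1 hj)]]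
  ring

theorem expVal_tail_le_one {M : ℕ} {a : ℕ → ℕ} {q : ℝ} (ha : ∀ i, a i ≤ M) (hq : 1 < q)
    (h1 : expVal a q = 1)
    (hlt : ∀ n ≥ 1, ∃ k, (∀ j < k, a (n + j) = a j) ∧ a (n + k) < a k) (n : ℕ) :
    expVal (fun i => a (n + i)) q ≤ 1 := by
  have hbdd : BddAbove (Set.range fun n => expVal (fun i => a (n + i)) q) :=
    ⟨M / (q - 1), by rintro _ ⟨n, rfl⟩; exact expVal_le (fun i => ha _) hq⟩
  set s := ⨆ n, expVal (fun i => a (n + i)) q with hs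
  have hle : ∀ n, expVal (fun i => a (n + i)) q ≤ s := le_ciSup hbdd
  suffices s ≤ 1 from (hle n).trans this
  by_contra! hs1
  have hbound : ∀ n, expVal (fun i => a (n + i)) q ≤ 1 + (s - 1) / q := by
    intro n
    have h0 : 0 ≤ (s - 1) / q := div_nonneg (by linarith) (by linarith)
    rcases Nat.eq_zero_or_pos n with rfl | hn
    · simp only [zero_add, h1]; linarith
    · obtain ⟨k, hk, hk'⟩ := hlt n hn
      have h2 := expVal_sub (b := fun i => a (n + i)) ha (fun i => ha _) hq hk
      have h3 := hle (n + (k + 1))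
      have h4 := expVal_nonneg (fun i => a (k + 1 + i)) hq
      have h5 : (a (n + k) : ℝ) + 1 ≤ a k := by exact_mod_cast hk'
      simp only [add_assoc] at h2 h3 h4
      have h6 : ((a (n + k) : ℝ) - a k + expVal (fun i => a (n + (k + (1 + i)))) q -
          expVal (fun i => a (k + (1 + i))) q) / q ^ (k + 1) ≤ (s - 1) / q ^ (k + 1) :=
        div_le_div_of_nonneg_right (by linarith) (by positivity)
      have h7 : (s - 1) / q ^ (k + 1) ≤ (s - 1) / q :=
        div_le_div_of_nonneg_left (by linarith) (by linarith) (le_self_pow₀ hq.le (by omega))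
      linarith
  have h2 : s ≤ 1 + (s - 1) / q := ciSup_le hbound
  have h3 : (s - 1) / q < s - 1 := div_lt_self (by linarith) hq
  linarith

theorem lexLE_antisymm {a b : ℕ → ℕ} (h1 : lexLE a b) (h2 : lexLE b a) : a = b := by
  rcases h1 with h1 | ⟨n, hn, hn'⟩
  · exact h1
  rcases h2 with h2 | ⟨m, hm, hm'⟩
  · exact h2.symm
  rcases lt_trichotomy n m with h | h | h
  · have := hm n h; omega
  · subst h; omega
  · have := hn m h; omega

theorem lexLE_of_not_lexLT {a b : ℕ → ℕ} (h : ¬ lexLT a b) : lexLE b a := by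
  classical
  by_cases hab : b = a
  · exact Or.inl hab
  · have hex : ∃ n, b n ≠ a n := Function.ne_iff.1 hab
    have h1 : ∀ i < Nat.find hex, b i = a i := fun i hi => not_not.1 (Nat.find_min hex hi)
    refine Or.inr ⟨Nat.find hex, h1, ?_⟩
    by_contra h2
    exact h ⟨Nat.find hex, fun i hi => (h1 i hi).symm,
      lt_of_le_of_ne (not_lt.1 h2) (Nat.find_spec hex).symm⟩

theorem qg_eq_of_expVal_eq_one {M : ℕ} {a : ℕ → ℕ} {q : ℝ} (ha : ∀ i, a i ≤ M) (hq : 1 < q)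
    (h1 : expVal a q = 1) (hinf : ∀ n, ∃ m ≥ n, a m ≠ 0)
    (hlt : ∀ n ≥ 1, ∃ k, (∀ j < k, a (n + j) = a j) ∧ a (n + k) < a k) : qg M q = a := by
  have hmax : IsQuasiGreedy M q a := by
    refine ⟨ha, hinf, h1, fun b hb hbinf hb1 => lexLE_of_not_lexLT ?_⟩
    rintro ⟨k, hk, hk'⟩
    have h2 := expVal_sub ha hb hq (fun j hj => (hk j hj).symm)
    rw [h1, expVal, hb1, sub_self] at h2
    have h3 := expVal_tail_le_one ha hq h1 hlt (k + 1)
    obtain ⟨m, hm, hm'⟩ := hbinf (k + 1)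
    have h4 := le_expVal (a := fun i => b (k + 1 + i)) (fun i => hb _) hq (j := m - (k + 1))
      (by rwa [Nat.add_sub_cancel' hm])
    have h5 : 0 < 1 / q ^ (m - (k + 1) + 1) := by positivity
    have h6 : (a k : ℝ) + 1 ≤ b k := by exact_mod_cast hk'
    have h7 : 0 < ((b k : ℝ) - a k + expVal (fun i => b (k + 1 + i)) q -
      expVal (fun i => a (k + 1 + i)) q) / q ^ (k + 1) := by
      apply div_pos _ (by positivity)
      linarith
    linarith
  have hex : ∃ a, IsQuasiGreedy M q a := ⟨a, hmax⟩
  have hspec : IsQuasiGreedy M q (qg M q) := by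
    rw [qg, dif_pos hex]; exact hex.choose_spec
  exact lexLE_antisymm (hmax.2.2.2 _ hspec.1 hspec.2.1 hspec.2.2.1)
    (hspec.2.2.2 _ hmax.1 hmax.2.1 hmax.2.2.1)

theorem expVal_antitone {M : ℕ} {a : ℕ → ℕ} {p q : ℝ} (ha : ∀ i, a i ≤ M) (hp : 1 < p)
    (hpq : p ≤ q) : expVal a q ≤ expVal a p := by
  refine (summable_expVal ha (hp.trans_le hpq)).tsum_le_tsum (fun i => ?_) (summable_expVal ha hp)
  gcongr

theorem expVal_sub_le {M : ℕ} {a : ℕ → ℕ} {p q : ℝ} (ha : ∀ i, a i ≤ M) (hp : 3 / 2 ≤ p)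
    (hpq : p ≤ q) : expVal a p - expVal a q ≤ 4 * M * (q - p) := by
  have hp1 : 1 < p := by linarith
  have hq1 : 1 < q := by linarith
  have h1 := (summable_expVal ha hp1).hasSum.sub (summable_expVal ha hq1).hasSum
  have h2 := (hasSum_expVal_const M hp1).sub (hasSum_expVal_const M hq1)
  have h3 := hasSum_le (fun i => ?_) h1 h2
  · refine h3.trans ?_
    have hp0 : 0 < p - 1 := by linarith
    have hq0 : 0 < q - 1 := by linarith
    have h4 : (M : ℝ) / (p - 1) - M / (q - 1) = M * (q - p) / ((p - 1) * (q - 1)) := by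
      field_simp
      ring
    rw [h4, div_le_iff₀ (by positivity)]
    have h5 : 1 ≤ 4 * ((p - 1) * (q - 1)) := by nlinarith
    have h6 : 0 ≤ M * (q - p) := mul_nonneg (by positivity) (by linarith)
    nlinarith
  · have h4 : 1 / q ^ (i + 1) ≤ 1 / p ^ (i + 1) := by gcongr
    have h5 : (a i : ℝ) ≤ M := by exact_mod_cast ha i
    have h6 : ∀ c : ℝ, c / p ^ (i + 1) - c / q ^ (i + 1) =
        c * (1 / p ^ (i + 1) - 1 / q ^ (i + 1)) := fun c => by ring
    rw [h6 (a i), h6 M]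
    exact mul_le_mul_of_nonneg_right h5 (sub_nonneg.2 h4)

theorem exists_expVal_eq_one {M : ℕ} {a : ℕ → ℕ} (hM : 1 ≤ M) (ha : ∀ i, a i ≤ M) (h0 : a 0 = M)
    (h1 : a 1 = M) : ∃ q : ℝ, 3 / 2 ≤ q ∧ q ≤ M + 1 ∧ expVal a q = 1 := by
  have hM' : (1 : ℝ) ≤ M := by exact_mod_cast hM
  have hlip : LipschitzOnWith (4 * M) (expVal a) (Set.Icc (3 / 2 : ℝ) (M + 1)) := by
    refine LipschitzOnWith.of_le_add_mul _ fun p hp q hq => ?_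
    simp only [NNReal.coe_mul, NNReal.coe_ofNat, NNReal.coe_natCast, Real.dist_eq]
    rcases le_total p q with h | h
    · have := expVal_sub_le ha hp.1 h
      rw [abs_sub_comm, abs_of_nonneg (by linarith)]
      linarith
    · have h3 := expVal_antitone ha (by linarith [hq.1]) h
      have h4 : 0 ≤ 4 * M * |p - q| := by positivity
      linarith
  have h2 : (1 : ℝ) ∈ Set.Icc (expVal a (M + 1)) (expVal a (3 / 2)) := by
    constructor
    · refine (expVal_le ha (by linarith)).trans ?_
      rw [add_sub_cancel_right, div_self (by linarith)]
    · have := (summable_expVal ha (q := 3 / 2) (by norm_num)).sum_le_tsum (Finset.range 2)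
        (fun i _ => by positivity)
      refine le_trans ?_ this
      simp only [Finset.sum_range_succ, Finset.sum_range_zero, h0, h1]
      norm_num
      linarith
  obtain ⟨q, hq, hq'⟩ := intermediate_value_Icc' (by linarith) hlip.continuousOn h2
  exact ⟨q, hq.1, hq.2, hq'⟩

theorem le_sub_of_expVal_eq_one {M m k : ℕ} {a b : ℕ → ℕ} {p q : ℝ} (hM : 1 ≤ M)
    (ha : ∀ i, a i ≤ M) (hb : ∀ i, b i ≤ M) (hp : 3 / 2 ≤ p) (hp' : p ≤ M + 1) (hq : 3 / 2 ≤ q)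
    (hap : expVal a p = 1) (hbq : expVal b q = 1)
    (hlt : ∀ n ≥ 1, ∃ k, (∀ j < k, a (n + j) = a j) ∧ a (n + k) < a k)
    (hb0 : ∃ j < m, b (k + 1 + j) ≠ 0)
    (hk : ∀ j < k, b j = a j) (hk' : a k < b k) :
    ((M : ℝ) + 1)⁻¹ ^ (k + 1 + m) / (4 * M) ≤ q - p := by
  have hp1 : 1 < p := by linarith
  have hM' : (1 : ℝ) ≤ M := by exact_mod_cast hM
  have h2 := expVal_sub ha hb hp1 hk
  have h3 := expVal_tail_le_one ha hp1 hap hlt (k + 1)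
  have h6 : (a k : ℝ) + 1 ≤ b k := by exact_mod_cast hk'
  obtain ⟨j, hj, hj'⟩ := hb0
  have h4 := le_expVal (a := fun i => b (k + 1 + i)) (fun i => hb _) hp1 hj'
  have h5 : ((M : ℝ) + 1)⁻¹ ^ m ≤ 1 / p ^ (j + 1) := by
    rw [inv_pow, ← one_div]
    gcongr
    calc p ^ (j + 1) ≤ p ^ m := pow_le_pow_right₀ hp1.le (by omega)
      _ ≤ _ := by gcongr
  have h7 : ((M : ℝ) + 1)⁻¹ ^ (k + 1 + m) ≤ expVal b p - 1 := by
    rw [hap] at h2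
    rw [h2, pow_add, inv_pow _ (k + 1), div_eq_inv_mul]
    refine mul_le_mul (inv_anti₀ (by positivity) ?_) (by linarith) (by positivity) (by positivity)
    gcongr
  have h8 : 0 < ((M : ℝ) + 1)⁻¹ ^ (k + 1 + m) := by positivity
  have hpq : p ≤ q := by
    by_contra! h
    have := expVal_antitone hb (by linarith) h.le
    linarith
  have h9 := expVal_sub_le hb hp hpq
  rw [div_le_iff₀ (by positivity)]
  linarith

theorem shift_iterate_apply (n : ℕ) (x : ℕ → ℕ) (i : ℕ) : shift^[n] x i = x (n + i) := by
  induction n generalizing x with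
  | zero => simp
  | succ n ih => rw [Function.iterate_succ_apply, ih, shift]; congr 1; omega

theorem lexLE.apply_le {a b : ℕ → ℕ} (h : lexLE a b) {i : ℕ} (hi : ∀ j < i, a j = b j) :
    a i ≤ b i := by
  rcases h with rfl | ⟨n, hn, hn'⟩
  · exact le_rfl
  · rcases lt_trichotomy n i with h | rfl | h
    · have := hi n h; omega
    · exact hn'.le
    · exact (hn i h).le

theorem limitSeq_lt {M N : ℕ} {x : ℕ → ℕ} (hM : 1 ≤ M) (hx : ∀ i, x i ≤ M) (n : ℕ) (hn : n ≥ 1) :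
    ∃ k, (∀ j < k, limitSeq M N x (n + j) = limitSeq M N x j) ∧
      limitSeq M N x (n + k) < limitSeq M N x k := by
  obtain ⟨b, ⟨k, -, -, h1, h2⟩, -⟩ := limitSeq_between (N := N) hM hx hn
  exact ⟨k, h1, h2⟩

theorem exists_limitSeq_ne_zero {M N : ℕ} {x : ℕ → ℕ} (hM : 1 ≤ M) (hx : ∀ i, x i ≤ M) {t : ℕ}
    (ht : 1 ≤ t) : ∃ j < N + 7, limitSeq M N x (t + j) ≠ 0 := by
  obtain ⟨b, -, i, -, -, h1, h2⟩ := limitSeq_between (N := N) hM hx ht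
  have hle := limitSeq_le (N := N) hM hx
  simp only [reflSeq] at h1 h2
  by_cases hi : i < N + 7
  · refine ⟨i, hi, fun h => ?_⟩
    have := hle i
    omega
  · refine ⟨N + 6, by omega, fun h => ?_⟩
    have := h1 (N + 6) (by omega)
    rw [limitSeq_zero] at this
    omega

theorem memV_limitSeq {M N : ℕ} {x : ℕ → ℕ} (hM : 1 ≤ M) (hx : ∀ i, x i ≤ M) :
    memV M (limitSeq M N x) := by
  have hle := limitSeq_le (N := N) hM hx
  refine ⟨hle, fun n => ?_⟩
  rcases Nat.eq_zero_or_pos n with rfl | hn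
  · refine ⟨Or.inr ⟨0, by simp, ?_⟩, Or.inl rfl⟩
    have := limitSeq_top (M := M) (N := N) (x := x) (i := 0) (by omega)
    simp only [reflSeq, Function.iterate_zero, id_eq]
    omega
  · obtain ⟨b, ⟨k, -, -, h1, h2⟩, i, -, -, h3, h4⟩ := limitSeq_between (N := N) hM hx hn
    simp only [reflSeq] at h3 h4
    refine ⟨Or.inr ⟨i, fun j hj => ?_, ?_⟩, Or.inr ⟨k, fun j hj => ?_, ?_⟩⟩
    · have := h3 j hj
      have := hle (n + j)
      rw [shift_iterate_apply, reflSeq]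
      omega
    · have := hle i
      rw [shift_iterate_apply, reflSeq]
      omega
    · rw [shift_iterate_apply, h1 j hj]
    · rw [shift_iterate_apply]
      exact h2

theorem admissible_of_inLang {M : ℕ} {q : ℝ} {w : List ℕ} (hw : InLang (Vq M q) w) :
    Admissible M (qg M q) (fun i => w.getD i 0) w.length := by
  obtain ⟨x, ⟨hx, hx'⟩, k, hk⟩ := hw
  refine ⟨fun i => ?_, fun t i hti => ?_⟩
  · beta_reduce
    by_cases hi : i < w.length
    · rw [← hk i hi]; exact hx _
    · rw [List.getD_eq_default _ _ (by omega)]; exact Nat.zero_le _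
  · obtain ⟨h1, h2⟩ := hx' (k + t)
    have hxw : ∀ j ≤ i, w.getD (t + j) 0 = shift^[k + t] x j := fun j hj => by
      rw [← hk _ (by omega), shift_iterate_apply, add_assoc]
    have hxM : ∀ j, shift^[k + t] x j ≤ M := fun j => by
      rw [shift_iterate_apply]; exact hx _
    constructor
    · intro h
      beta_reduce at h ⊢
      rw [hxw i le_rfl]
      exact h2.apply_le fun j hj => by rw [← hxw j hj.le, h j hj]
    · intro h
      have h3 : reflSeq M (qg M q) i ≤ shift^[k + t] x i := by
        refine h1.apply_le fun j hj => ?_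
        have h4 := h j hj
        simp only [reflSeq, hxw j hj.le] at h4 ⊢
        have := hxM j
        omega
      simp only [reflSeq, hxw i le_rfl] at h3 ⊢
      omega

theorem getD_map_range (f : ℕ → ℕ) {n i : ℕ} (hi : i < n) :
    ((List.range n).map f).getD i 0 = f i := by
  simp [List.getD_eq_getElem?_getD, hi]

theorem not_isSynchronised {M : ℕ} {q : ℝ} {a : ℕ → ℕ} (hq : qg M q = a) (ha : memV M a)
    (hlt : ∀ n ≥ 1, ∃ k, (∀ j < k, a (n + j) = a j) ∧ a (n + k) < a k)
    (hcont : ∀ w : List ℕ, Admissible M a (fun i => w.getD i 0) w.length →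
      ∃ n ≥ 1, ∀ i < w.length, a (n + i) = w.getD i 0) : ¬ IsSynchronised (Vq M q) := by
  rintro ⟨-, w, hw, hsync⟩
  have haV : a ∈ Vq M q := by
    refine ⟨ha.1, fun n => ?_⟩
    rw [hq]
    exact ha.2 n
  have hadm : ∀ {w}, InLang (Vq M q) w → Admissible M a (fun i => w.getD i 0) w.length :=
    fun h => hq ▸ admissible_of_inLang h
  obtain ⟨n, -, hn⟩ := hcont w (hadm hw)
  have hpre : InLang (Vq M q) (prefixWord a (n + w.length)) := by
    refine ⟨a, haV, 0, fun i hi => ?_⟩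
    simp only [prefixWord, List.length_map, List.length_range] at hi
    rw [prefixWord, getD_map_range a hi, zero_add]
  obtain ⟨m, hm1, hm⟩ := hcont _ (hadm hpre)
  replace hm : ∀ i < n + w.length, a (m + i) = a i := fun i hi => by
    rw [hm i (by simpa [prefixWord] using hi), prefixWord, getD_map_range a hi]
  obtain ⟨k, hk, hk'⟩ := hlt m hm1
  have hnk : n + w.length ≤ k := by
    by_contra! h
    have := hm k h
    omega
  set u := prefixWord a (m + n) with hu
  set v := (List.range (k + 1 - (n + w.length))).map (fun i => a (n + w.length + i)) with hv
  have hul : u.length = m + n := by simp [hu, prefixWord]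
  have hvl : v.length = k + 1 - (n + w.length) := by simp [hv]
  have hu' : ∀ i < m + n, u.getD i 0 = a i := fun i hi => getD_map_range a hi
  have hv' : ∀ i < k + 1 - (n + w.length), v.getD i 0 = a (n + w.length + i) :=
    fun i hi => getD_map_range _ hi
  have huw : ∀ i < m + n + w.length, (u ++ w).getD i 0 = a i := by
    intro i hi
    rcases lt_or_ge i (m + n) with h | h
    · rw [List.getD_append _ _ _ _ (by omega), hu' i h]
    · rw [List.getD_append_right _ _ _ _ (by omega), hul, ← hn _ (by omega), ← hm _ (by omega)]
      congr 1
      omega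
  have h1 : InLang (Vq M q) (u ++ w) := by
    refine ⟨a, haV, 0, fun i hi => ?_⟩
    rw [List.length_append, hul] at hi
    rw [huw i hi, zero_add]
  have h2 : InLang (Vq M q) (w ++ v) := by
    refine ⟨a, haV, n, fun i hi => ?_⟩
    rw [List.length_append, hvl] at hi
    rcases lt_or_ge i w.length with h | h
    · rw [List.getD_append _ _ _ _ h, hn i h]
    · rw [List.getD_append_right _ _ _ _ h, hv' _ (by omega)]
      congr 1
      omega
  have h3 := (hadm (hsync u v h1 h2)).2 0 (m + k)
    (by simp only [List.length_append, hul, hvl]; omega)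
  have huwl : (u ++ w).length = m + n + w.length := by rw [List.length_append, hul]
  have huwv : ∀ i, m + n + w.length ≤ i → i ≤ m + k → (u ++ w ++ v).getD i 0 = a (i - m) := by
    intro i h h'
    rw [List.getD_append_right _ _ _ _ (by omega), huwl, hv' _ (by omega)]
    congr 1
    omega
  have h4 := h3.1 fun j hj => by
    simp only [zero_add]
    rcases lt_or_ge j (m + n + w.length) with h | h
    · rw [List.getD_append _ _ _ _ (by omega), huw j h]
    · rw [huwv j h hj.le, ← hk _ (by omega)]
      congr 1
      omega
  simp only [zero_add] at h4
  rw [huwv _ (by omega) le_rfl, Nat.add_sub_cancel_left] at h4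
  omega

theorem base_limitSeq_mem {M N : ℕ} {x : ℕ → ℕ} (hM : 1 ≤ M) (hx : ∀ i, x i ≤ M) {q : ℝ}
    (hq : 3 / 2 ≤ q) (hqM : q ≤ M + 1) (h : expVal (limitSeq M N x) q = 1) :
    memVL M q ∧ ¬ IsSynchronised (Vq M q) := by
  have hq1 : 1 < q := by linarith
  have hqg : qg M q = limitSeq M N x :=
    qg_eq_of_expVal_eq_one (limitSeq_le hM hx) hq1 h
      (fun n => by
        obtain ⟨j, -, hj⟩ := exists_limitSeq_ne_zero (N := N) hM hx (t := n + 1) (by omega)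
        exact ⟨_, by omega, hj⟩)
      (limitSeq_lt hM hx)
  refine ⟨⟨hq1, hqM, ?_⟩, not_isSynchronised hqg (memV_limitSeq hM hx) (limitSeq_lt hM hx)
    fun w hw => limitSeq_contains hM hx hw⟩
  rw [hqg]
  exact memV_limitSeq hM hx

theorem exists_le_abs_sub_base {M N : ℕ} {x y : ℕ → ℕ} (hM : 1 ≤ M) (hN : 1 ≤ N)
    (hx : ∀ i, x i ≤ M) (hy : ∀ i, y i ≤ M) (hxy : x ≠ y) {p q : ℝ}
    (hp : 3 / 2 ≤ p) (hpM : p ≤ M + 1) (hp1 : expVal (limitSeq M N x) p = 1)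
    (hq : 3 / 2 ≤ q) (hqM : q ≤ M + 1) (hq1 : expVal (limitSeq M N y) q = 1) :
    ∃ j n, (∀ i < j, x i = y i) ∧ N * n ≤ N * (N + 11) + (N + 3) * j ∧
      ((M : ℝ) + 1)⁻¹ ^ (n + N + 8) / (4 * M) ≤ |p - q| := by
  classical
  have hex : ∃ j, x j ≠ y j := Function.ne_iff.1 hxy
  obtain ⟨n, hn, hn'⟩ := exists_limitSeq_eq M hN (Nat.find hex)
  refine ⟨Nat.find hex, n, fun i hi => not_not.1 (Nat.find_min hex hi), hn, ?_⟩
  have hne : limitSeq M N x n ≠ limitSeq M N y n := by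
    rw [hn', hn']; exact Nat.find_spec hex
  have hex' : ∃ k, limitSeq M N x k ≠ limitSeq M N y k := ⟨n, hne⟩
  obtain ⟨k, hkn, hk, hk'⟩ : ∃ k ≤ n, (∀ j < k, limitSeq M N x j = limitSeq M N y j) ∧
      limitSeq M N x k ≠ limitSeq M N y k :=
    ⟨Nat.find hex', Nat.find_min' hex' hne, fun i hi => not_not.1 (Nat.find_min hex' hi),
      Nat.find_spec hex'⟩
  have hpow : ((M : ℝ) + 1)⁻¹ ^ (n + N + 8) / (4 * M) ≤
      ((M : ℝ) + 1)⁻¹ ^ (k + 1 + (N + 7)) / (4 * M) := by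
    refine div_le_div_of_nonneg_right (pow_le_pow_of_le_one (by positivity) ?_ (by omega))
      (by positivity)
    exact inv_le_one_of_one_le₀ (by linarith [Nat.cast_nonneg (α := ℝ) M])
  refine hpow.trans ?_
  rcases lt_or_gt_of_ne hk' with h | h
  · rw [abs_sub_comm]
    exact (le_sub_of_expVal_eq_one hM (limitSeq_le hM hx) (limitSeq_le hM hy) hp hpM hq hp1 hq1
      (limitSeq_lt hM hx) (exists_limitSeq_ne_zero hM hy (by omega))
      (fun j hj => (hk j hj).symm) h).trans (le_abs_self _)
  · exact (le_sub_of_expVal_eq_one hM (limitSeq_le hM hy) (limitSeq_le hM hx) hq hqM hp hq1 hp1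
      (limitSeq_lt hM hy) (exists_limitSeq_ne_zero hM hx (by omega)) hk h).trans (le_abs_self _)

theorem inv_pow_le_const_mul_rpow {M N n j : ℕ} {d : ℝ} (hM : 1 ≤ M)
    (hn : N * n ≤ N * (N + 11) + (N + 3) * j)
    (hd : ((M : ℝ) + 1)⁻¹ ^ (n + N + 8) / (4 * M) ≤ d) :
    (((M : ℝ) + 1) ^ j)⁻¹ ≤ (4 * M) ^ ((N : ℝ) / (N + 3)) *
      ((M : ℝ) + 1) ^ (N * (N + 11) + N + 8) * d ^ ((N : ℝ) / (N + 3)) := by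
  have hM' : (1 : ℝ) ≤ M := by exact_mod_cast hM
  set r : ℝ := (N : ℝ) / (N + 3) with hr
  set B : ℝ := (M : ℝ) + 1 with hB
  have hB0 : 0 < B := by positivity
  have hr0 : 0 ≤ r := by positivity
  have hr1 : r ≤ 1 := by rw [hr, div_le_one (by positivity)]; linarith
  have hrn : r * n ≤ N * (N + 11) + j := by
    have h1 : (N : ℝ) * n ≤ N * (N + 11) + (N + 3) * j := by exact_mod_cast hn
    have h2 : (0 : ℝ) ≤ N * (N + 11) := by positivity
    have h3 : (0 : ℝ) ≤ N := by positivity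
    rw [hr, div_mul_eq_mul_div, div_le_iff₀ (by positivity)]
    nlinarith
  have h1 : (B⁻¹ ^ (n + N + 8) / (4 * M)) ^ r ≤ d ^ r :=
    Real.rpow_le_rpow (by positivity) hd hr0
  refine le_trans ?_ (mul_le_mul_of_nonneg_left h1 (by positivity))
  have h2 : (B⁻¹ ^ (n + N + 8) / (4 * M)) ^ r =
      B ^ (-(((n + N + 8 : ℕ) : ℝ) * r)) / (4 * M) ^ r := by
    rw [Real.div_rpow (by positivity) (by positivity), ← Real.rpow_natCast,
      Real.inv_rpow hB0.le, ← Real.rpow_neg hB0.le, ← Real.rpow_mul hB0.le, neg_mul]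
  have h3 : (0 : ℝ) < (4 * M) ^ r := by positivity
  have h4 : (4 * (M : ℝ)) ^ r * B ^ (N * (N + 11) + N + 8) *
      (B ^ (-(((n + N + 8 : ℕ) : ℝ) * r)) / (4 * M) ^ r) =
      B ^ (((N * (N + 11) + N + 8 : ℕ) : ℝ) + -(((n + N + 8 : ℕ) : ℝ) * r)) := by
    rw [Real.rpow_add hB0, Real.rpow_natCast]
    field_simp
  rw [h2, h4, ← Real.rpow_natCast, ← Real.rpow_neg hB0.le]
  refine Real.rpow_le_rpow_of_exponent_le (by linarith) ?_
  push_cast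
  have h5 : r * (N + 8) ≤ N + 8 := mul_le_of_le_one_left (by positivity) hr1
  nlinarith

theorem le_dimH_not_synchronised {M N : ℕ} (hM : 1 ≤ M) (hN : 1 ≤ N) :
    ENNReal.ofReal ((N : ℝ) / (N + 3)) ≤ dimH {q : ℝ | memVL M q ∧ ¬ IsSynchronised (Vq M q)} := by
  have hle : ∀ (x : ℕ → Fin (M + 1)) i, (x i : ℕ) ≤ M := fun x i => Fin.is_le _
  have hex : ∀ x : ℕ → Fin (M + 1), ∃ q : ℝ, 3 / 2 ≤ q ∧ q ≤ M + 1 ∧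
      expVal (limitSeq M N fun i => x i) q = 1 := fun x =>
    exists_expVal_eq_one hM (limitSeq_le hM (hle x)) (limitSeq_top (by omega))
      (limitSeq_top (by omega))
  choose Q hQ hQM hQ1 using hex
  have hM' : (1 : ℝ) ≤ M := by exact_mod_cast hM
  have hsep : ∀ x y, x ≠ y → ∃ j n, (∀ i < j, x i = y i) ∧
      N * n ≤ N * (N + 11) + (N + 3) * j ∧
      ((M : ℝ) + 1)⁻¹ ^ (n + N + 8) / (4 * M) ≤ |Q x - Q y| := fun x y hxy => by
    obtain ⟨j, n, h1, h2, h3⟩ := exists_le_abs_sub_base hM hN (hle x) (hle y)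
      (fun h => hxy (funext fun i => Fin.ext (congrFun h i)))
      (hQ x) (hQM x) (hQ1 x) (hQ y) (hQM y) (hQ1 y)
    exact ⟨j, n, fun i hi => Fin.ext (h1 i hi), h2, h3⟩
  have hinj : Function.Injective Q := fun x y h => by
    by_contra hxy
    obtain ⟨j, n, -, -, h3⟩ := hsep x y hxy
    rw [h, sub_self, abs_zero] at h3
    have : 0 < ((M : ℝ) + 1)⁻¹ ^ (n + N + 8) / (4 * M) := by positivity
    linarith
  set r : NNReal := (N : NNReal) / (N + 3) with hr
  have hrR : (r : ℝ) = (N : ℝ) / (N + 3) := by simp [hr]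
  have hr0 : 0 < r := by
    have : (0 : NNReal) < N := by exact_mod_cast hN
    positivity
  set c : ℝ := (4 * M) ^ ((N : ℝ) / (N + 3)) * ((M : ℝ) + 1) ^ (N * (N + 11) + N + 8) with hc
  have hc0 : 0 ≤ c := by positivity
  set f : ℝ → ℝ := Function.extend Q Real.ofDigits 0 with hf
  have hfQ : ∀ x, f (Q x) = Real.ofDigits x := fun x => hinj.extend_apply _ _ x
  have hholder : HolderOnWith c.toNNReal r f (Set.range Q) := by
    rintro _ ⟨x, rfl⟩ _ ⟨y, rfl⟩
    rcases eq_or_ne x y with rfl | hxy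
    · simp
    obtain ⟨j, n, h1, h2, h3⟩ := hsep x y hxy
    have h4 := (Real.abs_ofDigits_sub_ofDigits_le h1).trans
      ((by push_cast; exact inv_pow_le_const_mul_rpow hM h2 h3))
    rw [hfQ, hfQ, edist_dist, edist_dist, ← ENNReal.ofReal,
      ENNReal.ofReal_rpow_of_nonneg dist_nonneg r.coe_nonneg, ← ENNReal.ofReal_mul hc0,
      Real.dist_eq, Real.dist_eq, hrR]
    exact ENNReal.ofReal_le_ofReal h4
  have himage : Set.Ico (0 : ℝ) 1 ⊆ f '' Set.range Q := fun t ht =>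
    ⟨_, ⟨Real.digits t (M + 1), rfl⟩, by rw [hfQ, Real.ofDigits_digits (by omega) ht]⟩
  have h1 : (1 : ENNReal) ≤ dimH (Set.range Q) / r := by
    refine le_trans ?_ (hholder.dimH_image_le hr0)
    have h : dimH (Set.Ico (0 : ℝ) 1) = 1 := by
      rw [Real.dimH_of_nonempty_interior (by simp)]
      simp
    exact h.symm.trans_le (dimH_mono himage)
  have h2 : Set.range Q ⊆ {q : ℝ | memVL M q ∧ ¬ IsSynchronised (Vq M q)} := by
    rintro _ ⟨x, rfl⟩
    exact base_limitSeq_mem hM (hle x) (hQ x) (hQM x) (hQ1 x)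
  refine le_trans ?_ (dimH_mono h2)
  rw [ENNReal.le_div_iff_mul_le (Or.inl (by exact_mod_cast hr0.ne')) (Or.inl ENNReal.coe_ne_top),
    one_mul] at h1
  rw [← hrR, ENNReal.ofReal_coe_nnreal]
  exact h1

/-- The class `C5 = V_L \ C4` (non-synchronised) has full Hausdorff
dimension. -/
theorem dimH_not_synchronised (M : ℕ) (hM : 1 ≤ M) :
    dimH {q : ℝ | memVL M q ∧ ¬ IsSynchronised (Vq M q)} = 1 := by
  refine le_antisymm ((dimH_mono (Set.subset_univ _)).trans Real.dimH_univ.le) ?_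
  have h1 : Filter.Tendsto (fun N : ℕ => (N : ℝ) / (N + 3)) Filter.atTop (nhds 1) := by
    exact_mod_cast tendsto_natCast_div_add_atTop (3 : ℝ)
  have h2 := ENNReal.tendsto_ofReal h1
  rw [ENNReal.ofReal_one] at h2
  exact le_of_tendsto h2 ((Filter.eventually_ge_atTop 1).mono fun N hN =>
    le_dimH_not_synchronised hM hN)
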